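/- arXiv:2211.13427 — 8 statements merged into one kernel-verified Lean document; each statement's English description precedes it below -/
import Mathlib

section
/- For every N ≥ 1, every weight vector w ∈ W and every u ∈ ℝ^N, the order-based fairness measure satisfies ν_w(u) ≥ 0; moreover ν_w(u) = 0 if and only if u = α·1 for some α ∈ ℝ (where 1 is the all-ones vector). -/
/-- The nondecreasing rearrangement of `u`: `sortedVec u i` is the `i`-th smallest entry. -/
noncomputable def sortedVec {N : ℕ} (u : Fin N → ℝ) : Fin N → ℝ :=
  u ∘ Tuple.sort u

/-- The order-based functional `ν_w(u) = Σ_i w_i u_(i)`. -/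
noncomputable def nuw {N : ℕ} (w u : Fin N → ℝ) : ℝ :=
  ∑ i, w i * sortedVec u i

theorem exists_forall_nonneg_mul_sub {ι : Type*} [Finite ι] [LinearOrder ι] {w s : ι → ℝ}
    (hw : Monotone w) (hs : Monotone s) (hneg : ∃ i, w i ≤ 0) :
    ∃ c, ∀ i, 0 ≤ w i * (s i - c) := by
  obtain ⟨k, hk, hmax⟩ := Set.exists_max_image {i | w i ≤ 0} id (Set.toFinite _) hneg
  refine ⟨s k, fun j => ?_⟩
  rcases le_or_gt (w j) 0 with hj | hj
  · exact mul_nonneg_of_nonpos_of_nonpos hj (sub_nonpos.2 (hs (hmax j hj)))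
  · exact mul_nonneg hj.le (sub_nonneg.2 (hs (hw.reflect_lt (hk.trans_lt hj)).le))

theorem sortedVec_monotone {N : ℕ} (u : Fin N → ℝ) : Monotone (sortedVec u) :=
  Tuple.monotone_sort u

theorem nuw_eq_sum_mul_sub {N : ℕ} {w : Fin N → ℝ} (hsum : ∑ i, w i = 0) (u : Fin N → ℝ)
    (c : ℝ) : nuw w u = ∑ i, w i * (sortedVec u i - c) := by
  simp [nuw, mul_sub, Finset.sum_sub_distrib, ← Finset.sum_mul, hsum]

/-- For `N ≥ 1`, `w ∈ W` and `u ∈ ℝ^N`, the order-based fairness measure satisfies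
`ν_w(u) ≥ 0`, and `ν_w(u) = 0` iff `u = α·1` for some `α ∈ ℝ`. -/
theorem stmt0 {N : ℕ} (hN : 1 ≤ N) (w : Fin N → ℝ)
    (hsum : ∑ i, w i = 0) (hmono : Monotone w)
    (hw1 : w ⟨0, hN⟩ < 0) (hwN : 0 < w ⟨N - 1, Nat.sub_lt hN Nat.one_pos⟩)
    (u : Fin N → ℝ) :
    0 ≤ nuw w u ∧ (nuw w u = 0 ↔ ∃ α : ℝ, u = fun _ => α) := by
  obtain ⟨c, hc⟩ := exists_forall_nonneg_mul_sub hmono (sortedVec_monotone u) ⟨_, hw1.le⟩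
  rw [nuw_eq_sum_mul_sub hsum u c]
  refine ⟨Finset.sum_nonneg fun i _ => hc i, fun h => ⟨c, funext fun i => ?_⟩, ?_⟩
  · rw [Finset.sum_eq_zero_iff_of_nonneg fun i _ => hc i] at h
    have first := sub_eq_zero.1 ((mul_eq_zero.1 (h _ (Finset.mem_univ _))).resolve_left hw1.ne)
    have last := sub_eq_zero.1 ((mul_eq_zero.1 (h _ (Finset.mem_univ _))).resolve_left hwN.ne')
    set j := (Tuple.sort u).symm i with hj
    have hu : sortedVec u j = u i := by simp [sortedVec, hj]
    rw [← hu]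
    refine le_antisymm (last ▸ sortedVec_monotone u ?_) (first ▸ sortedVec_monotone u ?_)
    · exact Fin.mk_le_mk.2 (Nat.le_sub_one_of_lt j.isLt)
    · exact Fin.mk_le_mk.2 (Nat.zero_le _)
  · rintro ⟨α, rfl⟩
    rw [← nuw_eq_sum_mul_sub hsum]
    simp [nuw, sortedVec, ← Finset.sum_mul, hsum]
end

section
/- For every weight vector w ∈ W and all u¹, u² ∈ ℝ^N, if u¹ is majorized by u² then ν_w(u¹) ≤ ν_w(u²) (Schur convexity of order-based fairness measures). -/
/-- `x` is majorized by `y`: the sums agree and the top-tail sums of the sorted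
rearrangements satisfy `Σ_{i=k}^N x_(i) ≤ Σ_{i=k}^N y_(i)` for all `k ∈ {2,…,N}`. -/
def MajorizedBy {N : ℕ} (x y : Fin N → ℝ) : Prop :=
  (∑ i, x i) = (∑ i, y i) ∧
  ∀ k : ℕ, 2 ≤ k → k ≤ N →
    (∑ i ∈ Finset.univ.filter (fun i : Fin N => k ≤ (i : ℕ) + 1), sortedVec x i) ≤
      ∑ i ∈ Finset.univ.filter (fun i : Fin N => k ≤ (i : ℕ) + 1), sortedVec y i

/-- Abel summation bound: if all proper tail sums of `d` are nonnegative, then pairing `d` with a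
monotone `w` gives at least `w 0` times the total sum of `d`. -/
theorem Monotone.mul_sum_le_sum_mul {n : ℕ} {w d : Fin (n + 1) → ℝ} (hw : Monotone w)
    (hd : ∀ j : Fin n, 0 ≤ ∑ i ∈ Finset.Ici j.succ, d i) :
    w 0 * ∑ i, d i ≤ ∑ i, w i * d i := by
  induction n with
  | zero => simp
  | succ n ih =>
    have key := ih (w := fun i => w i.succ) (d := fun i => d i.succ)
      (fun _ _ h => hw (Fin.succ_le_succ_iff.mpr h))
      (fun j => by simpa only [Fin.sum_Ici_succ d] using hd j.succ)
    have htail : 0 ≤ ∑ i : Fin (n + 1), d i.succ := by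
      have h := hd 0
      rwa [Fin.sum_Ici_succ d, ← bot_eq_zero (α := Fin (n + 1)), Finset.Ici_bot] at h
    have hstep := mul_le_mul_of_nonneg_right (hw (Fin.zero_le (Fin.succ 0))) htail
    rw [Fin.sum_univ_succ, Fin.sum_univ_succ (fun i => w i * d i), mul_add]
    linarith

theorem sum_sortedVec {N : ℕ} (u : Fin N → ℝ) : ∑ i, sortedVec u i = ∑ i, u i :=
  Equiv.sum_comp (Tuple.sort u) u

/-- Schur convexity of order-based fairness measures: for `w ∈ W`, if `u¹` is majorized
by `u²` then `ν_w(u¹) ≤ ν_w(u²)`. -/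
theorem stmt1 {N : ℕ} (hN : 1 ≤ N) (w : Fin N → ℝ)
    (hsum : ∑ i, w i = 0) (hmono : Monotone w)
    (hw1 : w ⟨0, hN⟩ < 0) (hwN : 0 < w ⟨N - 1, Nat.sub_lt hN Nat.one_pos⟩)
    (u₁ u₂ : Fin N → ℝ) (hmaj : MajorizedBy u₁ u₂) :
    nuw w u₁ ≤ nuw w u₂ := by
  obtain ⟨n, rfl⟩ := Nat.exists_eq_add_of_le' hN
  obtain ⟨htotal, htails⟩ := hmaj
  have h := hmono.mul_sum_le_sum_mul (d := fun i => sortedVec u₂ i - sortedVec u₁ i) fun j => by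
    have hfilter : Finset.univ.filter (fun i : Fin (n + 1) => (j : ℕ) + 2 ≤ (i : ℕ) + 1) =
        Finset.Ici j.succ := by
      ext i
      simp [Fin.le_def]
    have hj := htails (j + 2) (by omega) (by omega)
    rw [hfilter] at hj
    rw [Finset.sum_sub_distrib]
    exact sub_nonneg.mpr hj
  simp only [mul_sub, Finset.sum_sub_distrib, sum_sortedVec, htotal, sub_self, mul_zero] at h
  exact sub_nonneg.mp h
end

section
/- Let N ≥ 2. For each k ∈ {1,…,N−1} define w^k ∈ ℝ^N by w^k_1 = −(N−k)−1, w^k_i = −1 for 2 ≤ i ≤ k, w^k_i = 1 for k+1 ≤ i ≤ N−1, and w^k_N = k+1. Then for every u ∈ ℝ^N, the sum of maximum pairwise deviations satisfies Σ_{i=1}^N max_{j ∈ {1,…,N}} |u_i − u_j| = max_{k ∈ {1,…,N−1}} Σ_{i=1}^N w^k_i · u_(i). -/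
/-- The weight vector `w^k ∈ ℝ^N` (positions are 1-based): `w^k_1 = −(N−k)−1`,
`w^k_i = −1` for `2 ≤ i ≤ k`, `w^k_i = 1` for `k+1 ≤ i ≤ N−1`, `w^k_N = k+1`. -/
noncomputable def wvec (N k : ℕ) : Fin N → ℝ := fun i =>
  if (i : ℕ) = 0 then -((N : ℝ) - (k : ℝ)) - 1
  else if (i : ℕ) + 1 ≤ k then -1
  else if (i : ℕ) + 1 ≤ N - 1 then 1
  else (k : ℝ) + 1

theorem iSup_abs_sub_eq_max {n : ℕ} {s : Fin (n + 1) → ℝ} (hs : Monotone s) (i : Fin (n + 1)) :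
    ⨆ j, |s i - s j| = max (s (Fin.last n) - s i) (s i - s 0) := by
  have hbdd : BddAbove (Set.range fun j => |s i - s j|) := (Set.finite_range _).bddAbove
  apply le_antisymm
  · refine ciSup_le fun j => ?_
    have h0 := hs (Fin.zero_le j)
    have hl := hs (Fin.le_last j)
    rw [abs_le']
    exact ⟨le_max_of_le_right (by linarith), le_max_of_le_left (by linarith)⟩
  · refine max_le ?_ ?_
    · exact (neg_sub (s i) _ ▸ neg_le_abs _).trans (le_ciSup hbdd (Fin.last n))
    · exact (le_abs_self _).trans (le_ciSup hbdd 0)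

theorem sum_iSup_abs_sub_comp_perm {ι : Type*} [Fintype ι] (u : ι → ℝ) (σ : Equiv.Perm ι) :
    ∑ i, ⨆ j, |u (σ i) - u (σ j)| = ∑ i, ⨆ j, |u i - u j| := by
  rw [← Equiv.sum_comp σ fun i => ⨆ j, |u i - u j|]
  exact Finset.sum_congr rfl fun i _ => σ.iSup_comp (g := fun j => |u (σ i) - u j|)

theorem wvec_eq_add {n k : ℕ} (hk : 1 ≤ k) (hkn : k ≤ n) (i : Fin (n + 1)) :
    wvec (n + 1) k i = (if (i : ℕ) < k then -1 else 1) +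
      ((if i = 0 then -((n : ℝ) + 1 - k) else 0) + if i = Fin.last n then (k : ℝ) else 0) := by
  have hi := i.isLt
  simp only [wvec, Fin.ext_iff, Fin.val_zero, Fin.val_last]
  push_cast
  split_ifs <;> first | omega | ring

/-- Splitting the sorted vector at `k`, measure the first `k` entries against the maximum and the
remaining ones against the minimum. -/
theorem sum_wvec_mul {n k : ℕ} (hk : 1 ≤ k) (hkn : k ≤ n) (s : Fin (n + 1) → ℝ) :
    ∑ i, wvec (n + 1) k i * s i =
      ∑ i : Fin (n + 1), if (i : ℕ) < k then s (Fin.last n) - s i else s i - s 0 := by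
  have hcard : ((Finset.univ.filter fun i : Fin (n + 1) => (i : ℕ) < k).card : ℝ) = k := by
    rw [Fin.card_filter_val_lt, min_eq_right (by omega)]
  have hconst : ∑ i : Fin (n + 1), (if (i : ℕ) < k then s (Fin.last n) + s 0 else 0) =
      k * (s (Fin.last n) + s 0) := by
    rw [← Finset.sum_filter, Finset.sum_const, nsmul_eq_mul, hcard]
  have hsplit : ∀ i : Fin (n + 1),
      (if (i : ℕ) < k then s (Fin.last n) - s i else s i - s 0) =
        (if (i : ℕ) < k then -1 else 1) * s i +
          ((if (i : ℕ) < k then s (Fin.last n) + s 0 else 0) - s 0) := by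
    intro i
    split_ifs <;> ring
  simp only [hsplit, wvec_eq_add hk hkn, add_mul, ite_mul, zero_mul, Finset.sum_add_distrib,
    Finset.sum_sub_distrib, Finset.sum_ite_eq', Finset.mem_univ, if_true, hconst,
    Finset.sum_const, Finset.card_univ, Fintype.card_fin, nsmul_eq_mul]
  push_cast
  ring

theorem exists_index_crossing_midpoint {n : ℕ} (hn : 1 ≤ n) {s : Fin (n + 1) → ℝ}
    (hs : Monotone s) :
    ∃ k, 1 ≤ k ∧ k ≤ n ∧
      (∀ i : Fin (n + 1), (i : ℕ) < k → 2 * s i ≤ s 0 + s (Fin.last n)) ∧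
      ∀ i : Fin (n + 1), k ≤ (i : ℕ) → s 0 + s (Fin.last n) ≤ 2 * s i := by
  classical
  have h0l := hs (Fin.zero_le (Fin.last n))
  have hex : ∃ k, 1 ≤ k ∧ ∃ h : k < n + 1, s 0 + s (Fin.last n) ≤ 2 * s ⟨k, h⟩ := by
    refine ⟨n, hn, n.lt_succ_self, ?_⟩
    change _ ≤ 2 * s (Fin.last n)
    linarith
  obtain ⟨hk, hkn, hle⟩ := Nat.find_spec hex
  refine ⟨Nat.find hex, hk, Nat.lt_succ_iff.mp hkn, fun i hi => ?_, fun i hi => ?_⟩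
  · rcases Nat.eq_zero_or_pos (i : ℕ) with h | h
    · rw [show i = 0 from Fin.ext h]
      linarith
    · by_contra! hlt
      exact Nat.find_min hex hi ⟨h, i.isLt, hlt.le⟩
  · have := hs (show (⟨Nat.find hex, hkn⟩ : Fin (n + 1)) ≤ i from hi)
    linarith

/-- The sum of maximum pairwise deviations equals the maximum over `k ∈ {1,…,N−1}` of
`Σ_i w^k_i u_(i)`, and this maximum is attained. -/
theorem stmt10 {N : ℕ} (hN : 2 ≤ N) (u : Fin N → ℝ) :
    IsGreatest ((fun k : ℕ => ∑ i, wvec N k i * sortedVec u i) '' Set.Icc 1 (N - 1))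
      (∑ i, ⨆ j, |u i - u j|) := by
  obtain ⟨n, rfl⟩ : ∃ n, N = n + 1 := ⟨N - 1, by omega⟩
  have hs : Monotone (sortedVec u) := Tuple.monotone_sort u
  have hsum : ∑ i, ⨆ j, |u i - u j| =
      ∑ i, max (sortedVec u (Fin.last n) - sortedVec u i) (sortedVec u i - sortedVec u 0) := by
    rw [← sum_iSup_abs_sub_comp_perm u (Tuple.sort u)]
    exact Finset.sum_congr rfl fun i _ => iSup_abs_sub_eq_max hs i
  rw [hsum, Nat.add_sub_cancel]
  constructor
  · obtain ⟨k, hk, hkn, hlt, hge⟩ := exists_index_crossing_midpoint (by omega : 1 ≤ n) hs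
    refine ⟨k, ⟨hk, hkn⟩, (sum_wvec_mul hk hkn _).trans (Finset.sum_congr rfl fun i _ => ?_)⟩
    split_ifs with h
    · have := hlt i h
      exact (max_eq_left (by linarith)).symm
    · have := hge i (not_lt.mp h)
      exact (max_eq_right (by linarith)).symm
  · rintro _ ⟨k, ⟨hk, hkn⟩, rfl⟩
    refine (sum_wvec_mul hk hkn _).trans_le (Finset.sum_le_sum fun i _ => ?_)
    split_ifs
    · exact le_max_left _ _
    · exact le_max_right _ _
end

section
/- Let ν₁ and ν₂ be convex fairness measures on ℝ^N and for k ∈ {1,2} define the dual set W_k = {w ∈ ℝ^N : w_1 ≤ … ≤ w_N and ⟨u, w⟩ ≤ ν_k(u) for all u ∈ ℝ^N} (the intersection of the effective domain of the convex conjugate of ν_k with the cone of nondecreasing vectors). Then there exists β > 0 with ν₁(u) = β·ν₂(u) for all u ∈ ℝ^N if and only if there exists β > 0 with W₁ = β·W₂ (the dilate of W₂ by factor β). -/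
open Pointwise

/-- A convex fairness measure: continuous, normalized, symmetric, translation invariant,
positively homogeneous, and convex. -/
def IsConvexFairnessMeasure {N : ℕ} (ν : (Fin N → ℝ) → ℝ) : Prop :=
  Continuous ν ∧
  (∀ u, 0 ≤ ν u) ∧
  (∀ u, ν u = 0 ↔ ∃ α : ℝ, u = fun _ => α) ∧
  (∀ (σ : Equiv.Perm (Fin N)) (u : Fin N → ℝ), ν (u ∘ σ) = ν u) ∧
  (∀ (α : ℝ) (u : Fin N → ℝ), ν (fun i => u i + α) = ν u) ∧
  (∀ (α : ℝ) (u : Fin N → ℝ), 0 < α → ν (α • u) = α * ν u) ∧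
  ConvexOn ℝ Set.univ ν

/-- The dual set of a convex fairness measure: nondecreasing vectors `w` with
`⟨u, w⟩ ≤ ν(u)` for all `u`. -/
def dualSet {N : ℕ} (ν : (Fin N → ℝ) → ℝ) : Set (Fin N → ℝ) :=
  {w | Monotone w ∧ ∀ u : Fin N → ℝ, (∑ i, u i * w i) ≤ ν u}

/-- The dual set of a positive multiple of `ν` is the corresponding dilate of the dual set. -/
theorem dualSet_const_mul {N : ℕ} (ν : (Fin N → ℝ) → ℝ) {β : ℝ} (hβ : 0 < β) :
    dualSet (fun u => β * ν u) = β • dualSet ν := by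
  ext w
  rw [Set.mem_smul_set_iff_inv_smul_mem₀ hβ.ne']
  refine and_congr ⟨fun h i j hij => ?_, fun h i j hij => ?_⟩ (forall_congr' fun u => ?_)
  · exact mul_le_mul_of_nonneg_left (h hij) (inv_pos.2 hβ).le
  · exact le_of_mul_le_mul_left (h hij) (inv_pos.2 hβ)
  · have : ∑ i, u i * (β⁻¹ • w) i = β⁻¹ * ∑ i, u i * w i := by
      rw [Finset.mul_sum]
      exact Finset.sum_congr rfl fun i _ => by simp only [Pi.smul_apply, smul_eq_mul]; ring
    rw [this, inv_mul_le_iff₀ hβ]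

namespace IsConvexFairnessMeasure

variable {N : ℕ} {ν : (Fin N → ℝ) → ℝ}

/-- A convex fairness measure is subadditive. -/
theorem add_le (h : IsConvexFairnessMeasure ν) (x y : Fin N → ℝ) : ν (x + y) ≤ ν x + ν y := by
  obtain ⟨-, -, -, -, -, hpos, hconv⟩ := h
  have := hconv.2 (Set.mem_univ ((2 : ℝ) • x)) (Set.mem_univ ((2 : ℝ) • y))
    (show (0 : ℝ) ≤ 1 / 2 by norm_num) (show (0 : ℝ) ≤ 1 / 2 by norm_num) (by norm_num)
  rw [hpos 2 x two_pos, hpos 2 y two_pos, smul_smul, smul_smul] at this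
  norm_num at this
  linarith

/-- Every point of a convex fairness measure is supported by a linear functional below it. -/
theorem exists_subgradient (h : IsConvexFairnessMeasure ν) (u : Fin N → ℝ) :
    ∃ w : Fin N → ℝ, (∀ v, ∑ i, v i * w i ≤ ν v) ∧ ν u = ∑ i, u i * w i := by
  have hadd := h.add_le
  obtain ⟨-, hnn, hz, -, -, hpos, -⟩ := h
  by_cases hu : u = 0
  · refine ⟨0, fun v => by simpa using hnn v, ?_⟩
    simpa using (hz u).2 ⟨0, hu⟩
  obtain ⟨g, hg, hgν⟩ := exists_extension_of_le_sublinear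
    (LinearPMap.mkSpanSingleton u (ν u) hu) ν (fun c hc x => hpos c x hc) hadd (by
      rintro ⟨x, hx⟩
      obtain ⟨c, rfl⟩ := Submodule.mem_span_singleton.1 hx
      refine (LinearPMap.mkSpanSingleton'_apply u (ν u) _ c hx).trans_le ?_
      rw [RingHom.id_apply, smul_eq_mul]
      rcases le_or_gt c 0 with hc | hc
      · exact (mul_nonpos_of_nonpos_of_nonneg hc (hnn u)).trans (hnn _)
      · exact (hpos c u hc).ge)
  have key : ∀ v, g v = ∑ i, v i * g (fun j => if i = j then 1 else 0) := fun v => by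
    simpa using g.pi_apply_eq_sum_univ v
  refine ⟨fun i => g (fun j => if i = j then 1 else 0), fun v => (key v).ge.trans (hgν v), ?_⟩
  rw [← key]
  have hmem := Submodule.mem_span_singleton_self (R := ℝ) u
  have := hg ⟨u, hmem⟩
  rw [this]
  exact (LinearPMap.mkSpanSingleton_apply ℝ _ hu (ν u)).symm

/-- A convex fairness measure is attained on its dual set after a rearrangement. -/
theorem exists_mem_dualSet (h : IsConvexFairnessMeasure ν) (u : Fin N → ℝ) :
    ∃ (σ : Equiv.Perm (Fin N)), ∃ w ∈ dualSet ν, ν u = ∑ i, (u ∘ σ) i * w i := by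
  obtain ⟨w, hw, hu⟩ := h.exists_subgradient u
  obtain ⟨-, -, -, hsymm, -⟩ := h
  refine ⟨Tuple.sort w, w ∘ Tuple.sort w, ⟨Tuple.monotone_sort w, fun v => ?_⟩, ?_⟩
  · rw [← hsymm (Tuple.sort w)⁻¹ v]
    refine le_of_eq_of_le ?_ (hw _)
    rw [← Equiv.sum_comp (Tuple.sort w) fun i => (v ∘ ⇑(Tuple.sort w)⁻¹) i * w i]
    simp
  · rw [hu]
    exact (Equiv.sum_comp (Tuple.sort w) fun i => u i * w i).symm

/-- Inclusion of dual sets orders the corresponding measures. -/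
theorem le_of_dualSet_subset {μ : (Fin N → ℝ) → ℝ} (h : IsConvexFairnessMeasure ν)
    (hμ : ∀ (σ : Equiv.Perm (Fin N)) (u : Fin N → ℝ), μ (u ∘ σ) = μ u)
    (hsub : dualSet ν ⊆ dualSet μ) (u : Fin N → ℝ) : ν u ≤ μ u := by
  obtain ⟨σ, w, hw, hu⟩ := h.exists_mem_dualSet u
  rw [hu, ← hμ σ u]
  exact (hsub hw).2 _

end IsConvexFairnessMeasure

/-- Two convex fairness measures are equivalent (one is a positive multiple of the other)
iff their dual sets are positive dilates of each other. -/
theorem stmt11 {N : ℕ} (ν₁ ν₂ : (Fin N → ℝ) → ℝ)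
    (h1 : IsConvexFairnessMeasure ν₁) (h2 : IsConvexFairnessMeasure ν₂) :
    (∃ β : ℝ, 0 < β ∧ ∀ u, ν₁ u = β * ν₂ u) ↔
      (∃ β : ℝ, 0 < β ∧ dualSet ν₁ = β • dualSet ν₂) := by
  refine exists_congr fun β => and_congr_right fun hβ => ⟨fun h => ?_, fun h u => ?_⟩
  · rw [funext h, dualSet_const_mul ν₂ hβ]
  have hs1 := h1.2.2.2.1
  have hs2 := h2.2.2.2.1
  apply le_antisymm
  · exact h1.le_of_dualSet_subset (μ := fun u => β * ν₂ u) (fun σ u => by rw [hs2])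
      (by rw [dualSet_const_mul ν₂ hβ, h]) u
  · rw [← le_inv_mul_iff₀ hβ]
    exact h2.le_of_dualSet_subset (μ := fun u => β⁻¹ * ν₁ u) (fun σ u => by rw [hs1])
      (by rw [dualSet_const_mul ν₁ (inv_pos.2 hβ), h, inv_smul_smul₀ hβ.ne']) u
end

section
/- Fix u, w ∈ ℝ^N and set u_max = max_i u_i, u_min = min_i u_i, λ̄ = (u_max − u_min)‖w‖_∞. Then there exists a pair (λ, θ) ∈ ℝ^N × ℝ^N that is feasible (λ_i + θ_j ≥ u_i w_j for all i, j) and optimal for the dual of the assignment problem, i.e., Σ_{i=1}^N (λ_i + θ_i) = max over permutations σ of Σ_{i=1}^N u_i w_{σ(i)}, and that satisfies the bounds 0 ≤ λ_i ≤ λ̄ for all i, and min{u_max·w_j, u_min·w_j} − λ̄ ≤ θ_j ≤ max{u_max·w_j, u_min·w_j} for all j. -/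
/-- A discrete subgradient potential: for monotone `a` and `b`, the sequence `b` is a selection of
subgradients along `a` of the partial sums of `b l * (a (l + 1) - a l)`. -/
theorem subgradient_sum_range {a b : ℕ → ℝ} (ha : Monotone a) (hb : Monotone b) (j k : ℕ) :
    (a k - a j) * b j ≤ ∑ l ∈ Finset.range k, b l * (a (l + 1) - a l)
      - ∑ l ∈ Finset.range j, b l * (a (l + 1) - a l) := by
  rcases le_total j k with h | h
  · induction k, h using Nat.le_induction with
    | base => simp
    | succ k hk ih =>
      rw [Finset.sum_range_succ]
      nlinarith [mul_nonneg (sub_nonneg.2 (hb hk)) (sub_nonneg.2 (ha k.le_succ))]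
  · induction j, h using Nat.le_induction with
    | base => simp
    | succ j hj ih =>
      rw [Finset.sum_range_succ]
      nlinarith [mul_nonneg (sub_nonneg.2 (hb j.le_succ)) (sub_nonneg.2 (ha (hj.trans j.le_succ)))]

/-- A pairing of `u` with `w` for which `w` is a selection of subgradients of some potential. -/
theorem exists_perm_subgradient {N : ℕ} (hN : 0 < N) (u w : Fin N → ℝ) :
    ∃ (τ : Equiv.Perm (Fin N)) (φ : Fin N → ℝ),
      ∀ i j, (u i - u j) * w (τ j) ≤ φ i - φ j := by
  let clamp : ℕ → Fin N := fun n => ⟨min n (N - 1), by omega⟩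
  have hclamp : Monotone clamp := fun m n h => by
    simp only [clamp, Fin.mk_le_mk]
    omega
  have hval (k : Fin N) : clamp k = k := by
    ext
    simp only [clamp]
    omega
  have key := subgradient_sum_range ((Tuple.monotone_sort u).comp hclamp)
    ((Tuple.monotone_sort w).comp hclamp)
  refine ⟨(Tuple.sort u).symm.trans (Tuple.sort w), fun i => ∑ l ∈ Finset.range
    ((Tuple.sort u).symm i), (w ∘ Tuple.sort w ∘ clamp) l *
      ((u ∘ Tuple.sort u ∘ clamp) (l + 1) - (u ∘ Tuple.sort u ∘ clamp) l), fun i j => ?_⟩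
  simpa [hval] using key ((Tuple.sort u).symm j) ((Tuple.sort u).symm i)


/-- Bounds on optimal dual variables for the assignment problem: there exist `(λ, θ)`
dual-feasible and optimal (their sum equals the max over permutations of `Σ_i u_i w_{σ(i)}`)
with `0 ≤ λ_i ≤ λ̄ = (u_max − u_min)‖w‖_∞` and
`min{u_max w_j, u_min w_j} − λ̄ ≤ θ_j ≤ max{u_max w_j, u_min w_j}`. -/
theorem stmt13 {N : ℕ} (hN : 0 < N) (u w : Fin N → ℝ) :
    ∃ lam th : Fin N → ℝ,
      (∀ i j, u i * w j ≤ lam i + th j) ∧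
      (∑ i, (lam i + th i)) = (⨆ σ : Equiv.Perm (Fin N), ∑ i, u i * w (σ i)) ∧
      (∀ i, 0 ≤ lam i ∧ lam i ≤ ((⨆ i, u i) - ⨅ i, u i) * ‖w‖) ∧
      (∀ j, min ((⨆ i, u i) * w j) ((⨅ i, u i) * w j) - ((⨆ i, u i) - ⨅ i, u i) * ‖w‖ ≤ th j ∧
        th j ≤ max ((⨆ i, u i) * w j) ((⨅ i, u i) * w j)) := by
  have : Nonempty (Fin N) := ⟨⟨0, hN⟩⟩
  obtain ⟨τ, φ, hφ⟩ := exists_perm_subgradient hN u w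
  have hle (i : Fin N) : u i ≤ ⨆ i, u i := le_ciSup (Set.finite_range u).bddAbove i
  have hge (i : Fin N) : ⨅ i, u i ≤ u i := ciInf_le (Set.finite_range u).bddBelow i
  obtain ⟨m, hm⟩ := Finite.exists_min φ
  have hosc (i : Fin N) : φ i - φ m ≤ ((⨆ i, u i) - ⨅ i, u i) * ‖w‖ := by
    calc φ i - φ m ≤ (u i - u m) * w (τ i) := by linarith [hφ m i]
      _ ≤ |u i - u m| * |w (τ i)| := by rw [← abs_mul]; exact le_abs_self _
      _ ≤ ((⨆ i, u i) - ⨅ i, u i) * ‖w‖ := by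
        gcongr
        · linarith [hle m, hge m]
        · rw [abs_le]
          constructor <;> linarith [hle m, hge m, hle i, hge i]
        · exact norm_le_pi_norm w (τ i)
  have hmax (x c : ℝ) (h₁ : ⨅ i, u i ≤ x) (h₂ : x ≤ ⨆ i, u i) :
      min ((⨆ i, u i) * c) ((⨅ i, u i) * c) ≤ x * c ∧
        x * c ≤ max ((⨆ i, u i) * c) ((⨅ i, u i) * c) := by
    rcases le_total 0 c with hc | hc
    · exact ⟨min_le_of_right_le (mul_le_mul_of_nonneg_right h₁ hc),
        le_max_of_le_left (mul_le_mul_of_nonneg_right h₂ hc)⟩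
    · exact ⟨min_le_of_left_le (mul_le_mul_of_nonpos_right h₂ hc),
        le_max_of_le_right (mul_le_mul_of_nonpos_right h₁ hc)⟩
  let lam : Fin N → ℝ := fun i => φ i - φ m
  let th : Fin N → ℝ := fun j => u (τ.symm j) * w j - lam (τ.symm j)
  have hfeas (i j : Fin N) : u i * w j ≤ lam i + th j := by
    have h := hφ i (τ.symm j)
    rw [Equiv.apply_symm_apply] at h
    simp only [lam, th]
    linarith
  have hsum (σ : Equiv.Perm (Fin N)) : ∑ i, (lam i + th i) = ∑ i, (lam i + th (σ i)) := by
    rw [Finset.sum_add_distrib, Finset.sum_add_distrib, Equiv.sum_comp σ th]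
  refine ⟨lam, th, hfeas, le_antisymm ?_ ?_, fun i => ⟨sub_nonneg.2 (hm i), hosc i⟩, fun j => ?_⟩
  · refine le_trans (le_of_eq ?_) (le_ciSup (Set.finite_range _).bddAbove τ)
    rw [hsum τ]
    simp [th]
  · refine ciSup_le fun σ => ?_
    rw [hsum σ]
    exact Finset.sum_le_sum fun i _ => hfeas i (σ i)
  · have h := hmax (u (τ.symm j)) (w j) (hge _) (hle _)
    have h₀ := hm (τ.symm j)
    have h₁ := hosc (τ.symm j)
    constructor <;> simp only [th, lam] <;> linarith [h.1, h.2]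
end

section
/- Let W₁ and W₂ be nonempty compact subsets of ℝ^N and define ν_k(u) = sup_{w ∈ W_k} ν_w(u) for k ∈ {1,2}. Then for every u ∈ ℝ^N, |ν₁(u) − ν₂(u)| ≤ d_H(W₁, W₂) · ‖u‖₂, where ‖·‖₂ is the Euclidean norm. -/
/-- The nondecreasing rearrangement of `u ∈ ℝ^N` (with the Euclidean structure):
`sortedVecE u i` is the `i`-th smallest entry. -/
noncomputable def sortedVecE {N : ℕ} (u : EuclideanSpace ℝ (Fin N)) : Fin N → ℝ :=
  (fun i => u i) ∘ Tuple.sort (fun i => u i)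

/-- The order-based functional `ν_w(u) = Σ_i w_i u_(i)`. -/
noncomputable def nuwE {N : ℕ} (w u : EuclideanSpace ℝ (Fin N)) : ℝ :=
  ∑ i, w i * sortedVecE u i

lemma norm_sortedVecE {N : ℕ} (u : EuclideanSpace ℝ (Fin N)) :
    ‖WithLp.toLp 2 (sortedVecE u)‖ = ‖u‖ := by
  rw [EuclideanSpace.norm_eq, EuclideanSpace.norm_eq]
  exact congrArg Real.sqrt
    (Equiv.sum_comp (Tuple.sort fun i => u i) fun i => ‖u i‖ ^ 2)

lemma nuwE_eq_inner {N : ℕ} (w u : EuclideanSpace ℝ (Fin N)) :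
    nuwE w u = inner ℝ (WithLp.toLp 2 (sortedVecE u)) w := by
  simp [nuwE, PiLp.inner_apply]

lemma nuwE_sub_le {N : ℕ} (v w u : EuclideanSpace ℝ (Fin N)) :
    nuwE v u - nuwE w u ≤ dist v w * ‖u‖ := by
  rw [nuwE_eq_inner, nuwE_eq_inner, ← inner_sub_right, dist_eq_norm, mul_comm,
    ← norm_sortedVecE u]
  exact real_inner_le_norm _ _

lemma bddAbove_image_nuwE {N : ℕ} {W : Set (EuclideanSpace ℝ (Fin N))} (hW : IsCompact W)
    (u : EuclideanSpace ℝ (Fin N)) : BddAbove ((fun w => nuwE w u) '' W) := by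
  refine hW.bddAbove_image (Continuous.continuousOn ?_)
  simp only [nuwE_eq_inner]
  fun_prop

lemma sSup_nuwE_sub_le {N : ℕ} {V W : Set (EuclideanSpace ℝ (Fin N))}
    (hV : V.Nonempty) (hW : W.Nonempty) (hcV : IsCompact V) (hcW : IsCompact W)
    (u : EuclideanSpace ℝ (Fin N)) :
    sSup ((fun w => nuwE w u) '' V) - sSup ((fun w => nuwE w u) '' W) ≤
      Metric.hausdorffDist V W * ‖u‖ := by
  rw [sub_le_iff_le_add]
  refine csSup_le (hV.image _) ?_
  rintro _ ⟨v, hv, rfl⟩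
  obtain ⟨w, hw, hvw⟩ := hcW.exists_infDist_eq_dist hW v
  have hdist : dist v w ≤ Metric.hausdorffDist V W :=
    hvw ▸ Metric.infDist_le_hausdorffDist_of_mem hv
      (Metric.hausdorffEDist_ne_top_of_nonempty_of_bounded hV hW hcV.isBounded hcW.isBounded)
  have hle : nuwE w u ≤ sSup ((fun w => nuwE w u) '' W) :=
    le_csSup (bddAbove_image_nuwE hcW u) ⟨w, hw, rfl⟩
  have hmul := mul_le_mul_of_nonneg_right hdist (norm_nonneg u)
  linarith [nuwE_sub_le v w u]

/-- For nonempty compact dual sets `W₁, W₂`, the associated convex fairness measures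
`ν_k(u) = sup_{w ∈ W_k} ν_w(u)` satisfy `|ν₁(u) − ν₂(u)| ≤ d_H(W₁, W₂)·‖u‖₂`, where `d_H`
is the Hausdorff distance w.r.t. the Euclidean metric and `‖·‖₂` the Euclidean norm. -/
theorem stmt14 {N : ℕ} (W₁ W₂ : Set (EuclideanSpace ℝ (Fin N)))
    (h1 : W₁.Nonempty) (h2 : W₂.Nonempty) (hc1 : IsCompact W₁) (hc2 : IsCompact W₂)
    (u : EuclideanSpace ℝ (Fin N)) :
    |sSup ((fun w => nuwE w u) '' W₁) - sSup ((fun w => nuwE w u) '' W₂)| ≤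
      Metric.hausdorffDist W₁ W₂ * ‖u‖ := by
  refine abs_sub_le_iff.2 ⟨sSup_nuwE_sub_le h1 h2 hc1 hc2 u, ?_⟩
  rw [Metric.hausdorffDist_comm]
  exact sSup_nuwE_sub_le h2 h1 hc2 hc1 u
end

section
/- For every N ≥ 1 and every u ∈ ℝ^N, the maximum sum of pairwise deviations equals N times the maximum absolute deviation from the mean: max_{i ∈ {1,…,N}} Σ_{j=1}^N |u_i − u_j| = N · max_{i ∈ {1,…,N}} |u_i − ū|, where ū = (1/N) Σ_{j=1}^N u_j. -/
/-- If numbers in `[-R, R]` sum to zero, then the absolute deviations from any point of `[-R, R]`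
sum to at most `R` times their number. -/
theorem sum_abs_sub_le_card_mul {ι : Type*} [Fintype ι] {v : ι → ℝ} {R x : ℝ}
    (hv : ∀ j, |v j| ≤ R) (hx : |x| ≤ R) (hsum : ∑ j, v j = 0) :
    ∑ j, |x - v j| ≤ Fintype.card ι * R := by
  rcases ((abs_nonneg x).trans hx).eq_or_lt with rfl | hR
  · have hx0 : x = 0 := abs_nonpos_iff.1 hx
    have hv0 : ∀ j, v j = 0 := fun j => abs_nonpos_iff.1 (hv j)
    simp [hx0, hv0]
  · have hpoint : ∀ j, R * |x - v j| ≤ R * R - x * v j := by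
      intro j
      obtain ⟨hx₁, hx₂⟩ := abs_le.1 hx
      obtain ⟨hv₁, hv₂⟩ := abs_le.1 (hv j)
      rcases abs_cases (x - v j) with ⟨h, -⟩ | ⟨h, -⟩ <;> rw [h]
      · nlinarith [mul_nonneg (sub_nonneg.2 hx₂) (neg_le_iff_add_nonneg.1 hv₁)]
      · nlinarith [mul_nonneg (sub_nonneg.2 hv₂) (neg_le_iff_add_nonneg.1 hx₁)]
    refine le_of_mul_le_mul_left ?_ hR
    calc R * ∑ j, |x - v j| = ∑ j, R * |x - v j| := Finset.mul_sum ..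
      _ ≤ ∑ j, (R * R - x * v j) := Finset.sum_le_sum fun j _ => hpoint j
      _ = R * (Fintype.card ι * R) := by
        rw [Finset.sum_sub_distrib, ← Finset.mul_sum (f := v), hsum, Finset.sum_const,
          Finset.card_univ, nsmul_eq_mul]
        ring

/-- The maximum sum of pairwise deviations equals `N` times the maximum absolute
deviation from the mean: `max_i Σ_j |u_i − u_j| = N · max_i |u_i − ū|`. -/
theorem stmt17 {N : ℕ} (hN : 1 ≤ N) (u : Fin N → ℝ) :
    (⨆ i, ∑ j, |u i - u j|) = (N : ℝ) * ⨆ i, |u i - (∑ j, u j) / (N : ℝ)| := by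
  have : Nonempty (Fin N) := ⟨⟨0, hN⟩⟩
  have hpos : (0 : ℝ) < N := by exact_mod_cast hN
  set m := (∑ j, u j) / (N : ℝ)
  have hNm : (N : ℝ) * m = ∑ j, u j := mul_div_cancel₀ _ hpos.ne'
  apply le_antisymm
  · have hdev : ∀ j, |u j - m| ≤ ⨆ i, |u i - m| :=
      le_ciSup (Set.finite_range fun i => |u i - m|).bddAbove
    have hsum : ∑ j, (u j - m) = 0 := by simp [Finset.sum_sub_distrib, hNm]
    refine ciSup_le fun i => ?_
    simpa using sum_abs_sub_le_card_mul hdev (hdev i) hsum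
  · rw [Real.mul_iSup_of_nonneg hpos.le]
    refine ciSup_mono (Set.finite_range _).bddAbove fun i => ?_
    calc (N : ℝ) * |u i - m| = |∑ j, (u i - u j)| := by
          rw [← abs_of_pos hpos, ← abs_mul, mul_sub, hNm]
          simp [Finset.sum_sub_distrib]
      _ ≤ ∑ j, |u i - u j| := Finset.abs_sum_le_sum_abs _ _
end

section
/- Let N ≥ 2 and for each i ∈ {1,…,N} let V_i : ℝ → ℝ be continuous and nondecreasing. Define the total envy E : ℝ^N → ℝ by E(u) = Σ_{i=1}^N Σ_{j=1}^N max{ V_i(u_j) − V_i(u_i), 0 }. Then E is a convex fairness measure if and only if there exists c > 0 and constants d_1,…,d_N ∈ ℝ such that V_i(y) = c·y + d_i for all y ∈ ℝ and all i; and in that case E(u) = c · Σ_{i=1}^N Σ_{j=i+1}^N |u_j − u_i|. -/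
/-- A double sum vanishing on the diagonal is a sum over the ordered pairs `i < j`. -/
theorem sum_sum_eq_sum_sum_lt {N : ℕ} (f : Fin N → Fin N → ℝ) (hf : ∀ i, f i i = 0) :
    ∑ i, ∑ j, f i j =
      ∑ i, ∑ j ∈ Finset.univ.filter (fun j : Fin N => i < j), (f i j + f j i) := by
  have hsplit : ∀ i j, f i j = (if i < j then f i j else 0) + (if j < i then f i j else 0) := by
    intro i j
    rcases lt_trichotomy i j with h | h | h
    · simp [h, h.not_gt]
    · simp [h, hf]
    · simp [h, h.not_gt]
  simp_rw [Finset.sum_add_distrib, Finset.sum_filter]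
  rw [Finset.sum_comm (f := fun i j => if i < j then f j i else 0), ← Finset.sum_add_distrib]
  refine Finset.sum_congr rfl fun i _ => ?_
  rw [← Finset.sum_add_distrib]
  exact Finset.sum_congr rfl fun j _ => hsplit i j

theorem isConvexFairnessMeasure_sum_max {N : ℕ} (hN : 2 ≤ N) {c : ℝ} (hc : 0 < c) :
    IsConvexFairnessMeasure
      (fun u : Fin N → ℝ => ∑ i, ∑ j, max (c * u j - c * u i) 0) := by
  have hnonneg : ∀ u : Fin N → ℝ, ∀ i, 0 ≤ ∑ j, max (c * u j - c * u i) 0 :=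
    fun u i => Finset.sum_nonneg fun j _ => le_max_right _ _
  refine ⟨by fun_prop, fun u => Finset.sum_nonneg fun i _ => hnonneg u i, fun u => ?_,
    fun σ u => ?_, fun α u => ?_, fun α u hα => ?_, convex_univ, ?_⟩
  · constructor
    · intro h
      have hle : ∀ i j, u j ≤ u i := by
        intro i j
        have hi := (Finset.sum_eq_zero_iff_of_nonneg fun i _ => hnonneg u i).1 h i
          (Finset.mem_univ i)
        have hij := (Finset.sum_eq_zero_iff_of_nonneg fun j _ => le_max_right _ _).1 hi j
          (Finset.mem_univ j)
        have := max_eq_right_iff.1 hij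
        nlinarith
      exact ⟨u ⟨0, by lia⟩, funext fun i => le_antisymm (hle _ _) (hle _ _)⟩
    · rintro ⟨α, rfl⟩
      simp
  · simp only [Function.comp_apply]
    rw [Equiv.sum_comp σ (fun i => ∑ j, max (c * u (σ j) - c * u i) 0)]
    exact Finset.sum_congr rfl fun i _ =>
      Equiv.sum_comp σ (fun j => max (c * u j - c * u i) 0)
  · simp only [mul_add, add_sub_add_right_eq_sub]
  · simp only [Finset.mul_sum, Pi.smul_apply, smul_eq_mul]
    refine Finset.sum_congr rfl fun i _ => Finset.sum_congr rfl fun j _ => ?_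
    rw [mul_max_of_nonneg _ _ hα.le]
    ring_nf
  · intro x _ y _ a b ha hb _
    simp only [smul_eq_mul, Finset.mul_sum, ← Finset.sum_add_distrib, Pi.add_apply,
      Pi.smul_apply]
    refine Finset.sum_le_sum fun i _ => Finset.sum_le_sum fun j _ => max_le ?_ ?_
    · have hx := mul_le_mul_of_nonneg_left (le_max_left (c * x j - c * x i) 0) ha
      have hy := mul_le_mul_of_nonneg_left (le_max_left (c * y j - c * y i) 0) hb
      linarith
    · positivity

/-- If only individual `i` is worse off than the others, then `i` is the only one who envies. -/
theorem sum_max_eq_of_one_worse {N : ℕ} {V : Fin N → ℝ → ℝ} (hmono : ∀ i, Monotone (V i))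
    (i : Fin N) {a b : ℝ} (hab : b ≤ a) :
    ∑ k, ∑ j, max (V k (if j = i then b else a) - V k (if k = i then b else a)) 0 =
      ((N : ℝ) - 1) * (V i a - V i b) := by
  rw [Finset.sum_eq_single i]
  · have hterm : ∀ j, max (V i (if j = i then b else a) - V i (if i = i then b else a)) 0 =
        (V i a - V i b) - (if j = i then V i a - V i b else 0) := by
      intro j
      by_cases h : j = i
      · simp [h]
      · simp [h, hmono i hab]
    rw [Finset.sum_congr rfl fun j _ => hterm j]
    simp only [Finset.sum_sub_distrib, Finset.sum_ite_eq', Finset.mem_univ, if_true,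
      Finset.sum_const, Finset.card_univ, Fintype.card_fin, nsmul_eq_mul]
    ring
  · intro k _ hk
    refine Finset.sum_eq_zero fun j _ => max_eq_right ?_
    rw [if_neg hk, sub_nonpos]
    refine hmono k ?_
    split_ifs
    exacts [hab, le_rfl]
  · simp

theorem exists_affine_of_isConvexFairnessMeasure {N : ℕ} (hN : 2 ≤ N) {V : Fin N → ℝ → ℝ}
    (hmono : ∀ i, Monotone (V i))
    (hE : IsConvexFairnessMeasure
      (fun u : Fin N → ℝ => ∑ i, ∑ j, max (V i (u j) - V i (u i)) 0)) :
    ∃ c : ℝ, 0 < c ∧ ∃ d : Fin N → ℝ, ∀ i y, V i y = c * y + d i := by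
  obtain ⟨-, hnonneg, hzero, hsymm, htrans, hhom, -⟩ := hE
  set E : (Fin N → ℝ) → ℝ := fun u => ∑ i, ∑ j, max (V i (u j) - V i (u i)) 0
  have hN1 : (0 : ℝ) < (N : ℝ) - 1 := by
    have : (2 : ℝ) ≤ N := by exact_mod_cast hN
    linarith
  let w : Fin N → Fin N → ℝ := fun i j => if j = i then 0 else 1
  let i₀ : Fin N := ⟨0, by lia⟩
  let i₁ : Fin N := ⟨1, by lia⟩
  have hw : ∀ i, E (w i) = E (w i₀) := by
    intro i
    rw [← hsymm (Equiv.swap i i₀) (w i₀)]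
    congr 1
    funext j
    have : Equiv.swap i i₀ j = i₀ ↔ j = i := by
      rw [Equiv.swap_apply_eq_iff, Equiv.swap_apply_right]
    simp [w, this]
  have hpos : 0 < E (w i₀) := by
    refine lt_of_le_of_ne (hnonneg _) fun h => ?_
    obtain ⟨α, hα⟩ := (hzero _).1 h.symm
    have h0 := congrFun hα i₀
    have h1 := congrFun hα i₁
    simp [w, i₀, i₁] at h0 h1
    linarith
  have hlt : ∀ i a b, b < a → V i a - V i b = E (w i₀) / ((N : ℝ) - 1) * (a - b) := by
    intro i a b hab
    have hu : (fun j => ((a - b) • w i) j + b) = fun j => if j = i then b else a := by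
      funext j
      by_cases h : j = i <;> simp [w, h]
    have h := sum_max_eq_of_one_worse hmono i hab.le
    have h' : E (fun j => if j = i then b else a) = (a - b) * E (w i₀) := by
      rw [← hu, htrans, hhom _ _ (sub_pos.2 hab), hw]
    have h'' := h.symm.trans h'
    field_simp
    linarith
  refine ⟨E (w i₀) / ((N : ℝ) - 1), div_pos hpos hN1, fun i => V i 0, fun i y => ?_⟩
  rcases lt_trichotomy y 0 with h | rfl | h
  · linarith [hlt i 0 y h]
  · simp
  · linarith [hlt i y 0 h]

/-- The total envy `E(u) = Σ_i Σ_j (V_i(u_j) − V_i(u_i))₊` (with each `V_i` continuous and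
nondecreasing) is a convex fairness measure iff all `V_i` are affine with a common positive
slope, i.e. `V_i(y) = c y + d_i` with `c > 0`; and in that case
`E(u) = c Σ_i Σ_{j>i} |u_j − u_i|`. -/
theorem stmt18 {N : ℕ} (hN : 2 ≤ N) (V : Fin N → ℝ → ℝ)
    (hcont : ∀ i, Continuous (V i)) (hmono : ∀ i, Monotone (V i)) :
    (IsConvexFairnessMeasure
        (fun u : Fin N → ℝ => ∑ i, ∑ j, max (V i (u j) - V i (u i)) 0) ↔
      ∃ c : ℝ, 0 < c ∧ ∃ d : Fin N → ℝ, ∀ i y, V i y = c * y + d i) ∧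
    (∀ c : ℝ, 0 < c → ∀ d : Fin N → ℝ, (∀ i y, V i y = c * y + d i) →
      ∀ u : Fin N → ℝ,
        (∑ i, ∑ j, max (V i (u j) - V i (u i)) 0) =
          c * ∑ i, ∑ j ∈ Finset.univ.filter (fun j : Fin N => i < j), |u j - u i|) := by
  have hfun : ∀ c : ℝ, ∀ d : Fin N → ℝ, (∀ i y, V i y = c * y + d i) →
      ∀ u : Fin N → ℝ, (∑ i, ∑ j, max (V i (u j) - V i (u i)) 0) =
        ∑ i, ∑ j, max (c * u j - c * u i) 0 := by
    intro c d hV u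
    simp only [hV, add_sub_add_right_eq_sub]
  refine ⟨⟨exists_affine_of_isConvexFairnessMeasure hN hmono, ?_⟩, ?_⟩
  · rintro ⟨c, hc, d, hV⟩
    rw [funext (hfun c d hV)]
    exact isConvexFairnessMeasure_sum_max hN hc
  · intro c hc d hV u
    rw [hfun c d hV u, sum_sum_eq_sum_sum_lt _ (by simp)]
    simp only [Finset.mul_sum]
    refine Finset.sum_congr rfl fun i _ => Finset.sum_congr rfl fun j _ => ?_
    rcases le_total (u i) (u j) with h | h
    · have := mul_le_mul_of_nonneg_left h hc.le
      rw [abs_of_nonneg (sub_nonneg.2 h), max_eq_left (sub_nonneg.2 this),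
        max_eq_right (sub_nonpos.2 this)]
      ring
    · have := mul_le_mul_of_nonneg_left h hc.le
      rw [abs_of_nonpos (sub_nonpos.2 h), max_eq_right (sub_nonpos.2 this),
        max_eq_left (sub_nonneg.2 this)]
      ring
end
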